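/- arXiv:1809.03803 — 2 statements merged into one kernel-verified Lean document; each statement's English description precedes it below -/
import Mathlib

section
/- For every natural number N ≥ 1, the least common multiple of the integers 1, 2, ..., N is at most 3^N. -/
open Nat

/-- Checks `lcm (1, ..., m) ≤ 3 ^ m` for `f` consecutive values `m = k, k + 1, ...`, given
`k`, `L = lcm (1, ..., k)` and `T = 3 ^ k`. The inner matches force evaluation of the arguments. -/
def lcmGo : ℕ → ℕ → ℕ → ℕ → Bool
  | 0, _, _, _ => true
  | f + 1, k, L, T =>
    Nat.casesOn L false fun L₁ =>
    Nat.casesOn T false fun T₁ =>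
    (Nat.ble L₁ T₁) &&
      lcmGo f (k + 1) (Nat.lcm (L₁ + 1) (k + 1)) ((T₁ + 1) * 3)

theorem lcmGo_spec (f k L T : ℕ) (hL : L = (Finset.Icc 1 k).lcm id) (hT : T = 3 ^ k)
    (h : lcmGo f k L T = true) :
    ∀ n, k ≤ n → n < k + f → (Finset.Icc 1 n).lcm id ≤ 3 ^ n := by
  induction f generalizing k L T with
  | zero => intro n h1 h2; omega
  | succ f ih =>
    intro n h1 h2
    rcases L with _ | L
    · simp [lcmGo] at h
    rcases T with _ | T
    · simp [lcmGo] at h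
    simp only [lcmGo, Bool.and_eq_true, Nat.ble_eq] at h
    rcases Nat.eq_or_lt_of_le h1 with rfl | h3
    · rw [← hL, ← hT]; exact Nat.succ_le_succ h.1
    · refine ih (k + 1) _ _ ?_ ?_ h.2 n h3 (by omega)
      · rw [hL, ← Finset.insert_Icc_right_eq_Icc_add_one (by omega), Finset.lcm_insert]
        exact Nat.lcm_comm _ _
      · rw [hT, pow_succ]

theorem lcmGo_small : lcmGo 2048 0 1 1 = true := by decide +kernel

theorem lcm_fac (n : ℕ) : lcmUpto n * ((n/2)! * (n/3)! * (n/7)! * (n/43)! * (n/1806)!) ∣ n ! * lcmUpto (n/1806) := by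
  have h0 : ∀ m, m ! ≠ 0 := Nat.factorial_ne_zero
  have h1 := lcmUpto_ne_zero
  rw [← Nat.factorization_prime_le_iff_dvd (by simp [h0, h1]) (by simp [h0,h1])]
  intro p hp
  have hf : ∀ m ≤ n, (m !).factorization p = ∑ i ∈ Finset.Ico 1 (Nat.log p n + 1), m / p^i := fun m hm =>
    Nat.factorization_factorial hp (Nat.lt_succ_of_le (Nat.log_mono_right hm))
  have hl : ∀ m ≤ n, (lcmUpto m).factorization p = ∑ i ∈ Finset.Ico 1 (Nat.log p n + 1), if 1 ≤ m / p^i then 1 else 0 := by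
    intro m hm
    rw [factorization_lcmUpto m hp, ← Finset.card_filter]
    have : (Finset.Ico 1 (Nat.log p n + 1)).filter (fun i => 1 ≤ m / p^i) = Finset.Ico 1 (Nat.log p m + 1) := by
      ext i
      have hlm : Nat.log p m ≤ Nat.log p n := Nat.log_mono_right hm
      simp only [Finset.mem_filter, Finset.mem_Ico, Nat.one_le_div_iff (pow_pos hp.pos i)]
      constructor
      · rintro ⟨h1, h2⟩
        exact ⟨h1.1, Nat.lt_succ_of_le (Nat.le_log_of_pow_le hp.one_lt h2)⟩
      · rintro ⟨h1, h2⟩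
        have : m ≠ 0 := by rintro rfl; simp at h2; omega
        exact ⟨⟨h1, by omega⟩, Nat.pow_le_of_le_log this (by omega)⟩
    rw [this]; simp
  have hd : ∀ a, n / a ≤ n := fun a => Nat.div_le_self _ _
  simp only [Nat.factorization_mul, h0, h1, ne_eq, not_false_eq_true, mul_eq_zero, or_self, Finsupp.add_apply]
  rw [hf _ le_rfl, hf _ (hd 2), hf _ (hd 3), hf _ (hd 7), hf _ (hd 43), hf _ (hd 1806), hl _ le_rfl, hl _ (hd 1806)]
  simp only [← Finset.sum_add_distrib]
  apply Finset.sum_le_sum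
  intro i _
  simp only [Nat.div_right_comm n _ (p^i)]
  generalize n / p^i = x
  split_ifs <;> omega

theorem merge {s t : ℕ} {w v c d x y : ℝ} (hx : 0 ≤ x) (hy : 0 ≤ y) (hv : 0 ≤ v)
    (hc : 0 ≤ c) (hd : 0 ≤ d)
    (h1 : (s ! : ℝ) * w ≤ c * x ^ s) (h2 : (t ! : ℝ) * v ≤ d * y ^ t) :
    ((s + t)! : ℝ) * (w * v) ≤ c * d * (x + y) ^ (s + t) := by
  have e : ((s + t)! : ℝ) = (s + t).choose s * (s ! * t !) := by
    have := Nat.add_choose_mul_factorial_mul_factorial s t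
    rw [Nat.choose_symm_add, ← this, Nat.cast_mul, Nat.cast_mul]; ring
  have hb : x ^ s * y ^ t * ((s + t).choose s : ℝ) ≤ (x + y) ^ (s + t) := by
    rw [add_pow]
    have := Finset.single_le_sum
      (f := fun m => x ^ m * y ^ (s + t - m) * ((s + t).choose m : ℝ))
      (s := Finset.range (s + t + 1)) (a := s)
      (fun i _ => by positivity) (by simp only [Finset.mem_range]; omega)
    simpa using this
  calc ((s + t)! : ℝ) * (w * v) = (s + t).choose s * ((s ! * w) * (t ! * v)) := by rw [e]; ring
    _ ≤ (s + t).choose s * ((c * x ^ s) * (d * y ^ t)) := by gcongr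
    _ = c * d * (x ^ s * y ^ t * ((s + t).choose s : ℝ)) := by ring
    _ ≤ _ := by gcongr

theorem multinom (a b c d e : ℕ) :
    (a + b + c + d + e)! ≤
      a ! * b ! * c ! * d ! * e ! * (2 ^ a * 3 ^ b * 7 ^ c * 43 ^ d * 1806 ^ e) := by
  have base : ∀ (m : ℕ) (x : ℝ), (m ! : ℝ) * x ^ m ≤ m ! * x ^ m := fun _ _ => le_rfl
  have h := merge (by norm_num) (by norm_num) (by positivity) (by positivity) (by positivity)
    (merge (by norm_num) (by norm_num) (by positivity) (by positivity) (by positivity)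
    (merge (by norm_num) (by norm_num) (by positivity) (by positivity) (by positivity)
    (merge (by norm_num) (by norm_num) (by positivity) (by positivity) (by positivity)
      (base a (1 / 2)) (base b (1 / 3))) (base c (1 / 7))) (base d (1 / 43))) (base e (1 / 1806))
  rw [show ((1 : ℝ) / 2 + 1 / 3 + 1 / 7 + 1 / 43 + 1 / 1806) = 1 by norm_num, one_pow, mul_one] at h
  simp only [one_div, inv_pow, ← mul_inv] at h
  rw [← div_eq_mul_inv, div_le_iff₀ (by positivity)] at h
  exact_mod_cast h

theorem fac_le (s r : ℕ) : (s + r)! ≤ s ! * (s + r) ^ r := by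
  rw [← Nat.factorial_mul_descFactorial (Nat.le_add_left r s), Nat.add_sub_cancel]
  exact Nat.mul_le_mul_left _ (Nat.descFactorial_le_pow _ _)

theorem lcm_step (n : ℕ) (hn : 1 ≤ n) : lcmUpto n ≤
    2 ^ (n / 2) * 3 ^ (n / 3) * 7 ^ (n / 7) * 43 ^ (n / 43) * 1806 ^ (n / 1806) * n ^ 4
      * lcmUpto (n / 1806) := by
  have h1 := Nat.le_of_dvd (Nat.mul_pos (Nat.factorial_pos _) (lcmUpto_pos _)) (lcm_fac n)
  obtain ⟨r, hr, hr4⟩ : ∃ r, n = (n / 2 + n / 3 + n / 7 + n / 43 + n / 1806) + r ∧ r ≤ 4 :=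
    ⟨n - (n / 2 + n / 3 + n / 7 + n / 43 + n / 1806), by omega, by omega⟩
  have h2 := fac_le (n / 2 + n / 3 + n / 7 + n / 43 + n / 1806) r
  rw [← hr] at h2
  have h3 := multinom (n / 2) (n / 3) (n / 7) (n / 43) (n / 1806)
  have h4 : n ^ r ≤ n ^ 4 := Nat.pow_le_pow_right hn hr4
  have h5 : 0 < (n / 2)! * (n / 3)! * (n / 7)! * (n / 43)! * (n / 1806)! := by positivity
  refine Nat.le_of_mul_le_mul_right (h1.trans ?_) h5
  refine (Nat.mul_le_mul_right _ (h2.trans (Nat.mul_le_mul h3 h4))).trans (le_of_eq ?_)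
  ring

set_option exponentiation.threshold 2000 in
theorem num_ineq (n : ℕ) (hn : 2048 ≤ n) :
    2 ^ (n / 2) * 3 ^ (n / 3) * 7 ^ (n / 7) * 43 ^ (n / 43) * 1806 ^ (n / 1806) * n ^ 4
      * 3 ^ (n / 1806) ≤ 3 ^ n := by
  have key : (2 : ℝ) ^ 903 * 3 ^ 602 * 7 ^ 258 * 43 ^ 42 * 1806 * 3 * 2 ^ 40 ≤ 3 ^ 1806 := by
    norm_num
  have hn0 : (0 : ℝ) < n := by positivity
  have hnR : (2048 : ℝ) ≤ n := by exact_mod_cast hn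
  have key2 := Real.log_le_log (by positivity) key
  rw [Real.log_mul (by positivity) (by positivity), Real.log_mul (by positivity) (by positivity),
    Real.log_mul (by positivity) (by positivity), Real.log_mul (by positivity) (by positivity),
    Real.log_mul (by positivity) (by positivity), Real.log_mul (by positivity) (by positivity)]
    at key2
  simp only [Real.log_pow] at key2
  push_cast at key2
  have hlog : Real.log n ≤ 11 * Real.log 2 + (n / 2048 - 1) := by
    have h := Real.log_le_sub_one_of_pos (show (0 : ℝ) < n / 2048 by positivity)
    rw [Real.log_div (by positivity) (by norm_num), show (2048 : ℝ) = 2 ^ 11 by norm_num,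
      Real.log_pow] at h
    push_cast at h
    norm_num at h ⊢
    linarith
  have hl2 := Real.log_two_gt_d9
  have hd : ∀ a : ℕ, ((n / a : ℕ) : ℝ) ≤ n / a := fun a => Nat.cast_div_le
  have hm : ∀ a b : ℕ, 1 ≤ b → ((n / a : ℕ) : ℝ) * Real.log b ≤ n / a * Real.log b := fun a b hb =>
    mul_le_mul_of_nonneg_right (hd a) (Real.log_nonneg (by exact_mod_cast hb))
  have g1 := hm 2 2 (by norm_num)
  have g2 := hm 3 3 (by norm_num)
  have g3 := hm 7 7 (by norm_num)
  have g4 := hm 43 43 (by norm_num)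
  have g5 := hm 1806 1806 (by norm_num)
  have g6 := hm 1806 3 (by norm_num)
  have key3 := mul_le_mul_of_nonneg_left key2 hn0.le
  have main : 4 * Real.log n ≤ 40 * n / 1806 * Real.log 2 := by
    have : (n - 2048 : ℝ) * 0.69 ≤ (n - 2048) * Real.log 2 :=
      mul_le_mul_of_nonneg_left (by linarith) (by linarith)
    linarith
  have goalR : (2 : ℝ) ^ (n / 2) * 3 ^ (n / 3) * 7 ^ (n / 7) * 43 ^ (n / 43) * 1806 ^ (n / 1806)
      * n ^ 4 * 3 ^ (n / 1806) ≤ 3 ^ n := by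
    rw [← Real.log_le_log_iff (by positivity) (by positivity),
      Real.log_mul (by positivity) (by positivity), Real.log_mul (by positivity) (by positivity),
      Real.log_mul (by positivity) (by positivity), Real.log_mul (by positivity) (by positivity),
      Real.log_mul (by positivity) (by positivity), Real.log_mul (by positivity) (by positivity)]
    simp only [Real.log_pow]
    push_cast at g1 g2 g3 g4 g5 g6 ⊢
    linarith
  exact_mod_cast goalR

/-- For every natural number `N ≥ 1`, the least common multiple of `1, 2, ..., N`
is at most `3 ^ N`. -/
theorem lcm_Icc_le_three_pow (N : ℕ) (hN : 1 ≤ N) :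
    (Finset.Icc 1 N).lcm id ≤ 3 ^ N := by
  induction N using Nat.strong_induction_on with
  | _ N ih =>
    rcases lt_or_ge N 2048 with h | h
    · exact lcmGo_spec 2048 0 1 1 (by simp) (by simp) lcmGo_small N (by omega) (by omega)
    · have h1 := ih (N / 1806) (by omega) (by omega)
      exact (lcm_step N hN).trans ((Nat.mul_le_mul_left _ h1).trans (num_ineq N h))
end

section
/- Fix ρ ∈ (0,2) and set D = ⌈2/ρ⌉. For N ∈ ℕ, let P_N ⊆ ℕ be defined as the product set {divisors of Q₀} · {n ≤ N : all prime factors of n lie in (N^{ρ/2}, N]}, where Q₀ = lcm{n ≤ N : n has no prime factor in (N^{ρ/2}, N]}. Then: (a) {1,...,N} ⊆ P_N; (b) lcm(P_N) = lcm(1,...,N) ≤ 3^N; and (c) Q₀ ≤ 3^{2D·N^{ρ/2}}, so that every element of P_N is at most max(N, e^{N^ρ}) for N sufficiently large depending on ρ. -/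
open Finset

/-- `n` has all its prime factors in the interval `(N^{ρ/2}, N]`. -/
def AllFactorsLarge (ρ : ℝ) (N n : ℕ) : Prop :=
  ∀ p : ℕ, p.Prime → p ∣ n → ((N : ℝ) ^ (ρ / 2) < (p : ℝ) ∧ p ≤ N)

/-- `n` has no prime factor in the interval `(N^{ρ/2}, N]`. -/
def NoLargeFactor (ρ : ℝ) (N n : ℕ) : Prop :=
  ∀ p : ℕ, p.Prime → p ∣ n → ¬((N : ℝ) ^ (ρ / 2) < (p : ℝ) ∧ p ≤ N)

open Classical in
/-- `Q₀ = lcm {n ≤ N : n has no prime factor in (N^{ρ/2}, N]}`. -/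
noncomputable def Qzero (ρ : ℝ) (N : ℕ) : ℕ :=
  ((Finset.Icc 1 N).filter (NoLargeFactor ρ N)).lcm id

open Classical in
/-- The Ionescu–Wainger set of denominators
`P_N = {d : d ∣ Q₀} · {n ≤ N : all prime factors of n in (N^{ρ/2}, N]}`. -/
noncomputable def IWDenom (ρ : ℝ) (N : ℕ) : Finset ℕ :=
  ((Qzero ρ N).divisors ×ˢ ((Finset.Icc 1 N).filter (AllFactorsLarge ρ N))).image
    (fun p => p.1 * p.2)


/-- Evaluate `L` to a literal before passing it to `f` (helps kernel evaluation). -/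
noncomputable def hansonForce (L : ℕ) (f : ℕ → Bool) : Bool :=
  Nat.rec (motive := fun _ => Bool) (f 0) (fun k _ => f (k + 1)) L

theorem hansonForce_eq (L : ℕ) (f : ℕ → Bool) : hansonForce L f = f L := by
  cases L <;> rfl

/-- Successive check that `lcm(1,…,n) ≤ 3^n`. -/
noncomputable def hansonCheck (fuel : ℕ) : ℕ → ℕ → Bool :=
  Nat.rec (motive := fun _ => ℕ → ℕ → Bool) (fun _ _ => true)
    (fun _ ih n L => hansonForce (n + 1) fun m =>
      hansonForce (L * m / Nat.gcd L m) fun L' =>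
        Bool.rec false (ih m L') (Nat.ble L' (3 ^ m))) fuel

theorem hansonCheck_succ (fuel n L : ℕ) :
    hansonCheck (fuel + 1) n L =
      Bool.rec false (hansonCheck fuel (n + 1) (Nat.lcm L (n + 1)))
        (Nat.ble (Nat.lcm L (n + 1)) (3 ^ (n + 1))) := by
  change hansonForce (n + 1) _ = _
  refine (hansonForce_eq _ _).trans ?_
  exact hansonForce_eq _ _

theorem lcmUpto_succ_eq (n : ℕ) : Nat.lcmUpto (n + 1) = Nat.lcm (Nat.lcmUpto n) (n + 1) := by
  unfold Nat.lcmUpto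
  rw [← Finset.insert_Icc_right_eq_Icc_add_one (by omega : 1 ≤ n + 1), Finset.lcm_insert, lcm_comm]
  rfl

theorem hansonCheck_sound (fuel : ℕ) : ∀ n, hansonCheck fuel n (Nat.lcmUpto n) = true →
    ∀ k, n < k → k ≤ n + fuel → Nat.lcmUpto k ≤ 3 ^ k := by
  induction fuel with
  | zero => intro n _ k h1 h2; omega
  | succ f ih =>
    intro n h k h1 h2
    rw [hansonCheck_succ, ← lcmUpto_succ_eq] at h
    cases hb : Nat.ble (Nat.lcmUpto (n + 1)) (3 ^ (n + 1)) with
    | false => rw [hb] at h; simp at h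
    | true =>
      rw [hb] at h
      rcases Nat.lt_or_ge (n + 1) k with h3 | h3
      · exact ih (n + 1) h k h3 (by omega)
      · obtain rfl : k = n + 1 := by omega
        exact Nat.le_of_ble_eq_true hb

theorem hansonCheck_true : hansonCheck 2048 0 1 = true := by decide +kernel

theorem hanson_small (n : ℕ) (h : n ≤ 2048) : Nat.lcmUpto n ≤ 3 ^ n := by
  rcases Nat.eq_zero_or_pos n with rfl | h0
  · simp [Nat.lcmUpto]
  · refine hansonCheck_sound 2048 0 ?_ n h0 (by omega)
    have : Nat.lcmUpto 0 = 1 := by simp [Nat.lcmUpto]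
    rw [this]; exact hansonCheck_true

theorem hanson_floor (t : ℕ) :
    (if 1 ≤ t then 1 else 0) + (t / 2 + t / 3 + t / 7 + t / 43 + t / 1806) ≤
      (if 1 ≤ t / 1806 then 1 else 0) + t := by
  split_ifs <;> omega

theorem log_eq_sum_ite {p : ℕ} (hp : p.Prime) {n b : ℕ} (hb : Nat.log p n < b) :
    Nat.log p n = ∑ i ∈ Finset.Ico 1 b, (if 1 ≤ n / p ^ i then 1 else 0) := by
  rw [Finset.sum_boole]
  have : (Finset.Ico 1 b).filter (fun i => 1 ≤ n / p ^ i) = Finset.Ico 1 (Nat.log p n + 1) := by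
    ext i
    simp only [Finset.mem_filter, Finset.mem_Ico]
    have hpi : 0 < p ^ i := pow_pos hp.pos i
    rw [Nat.one_le_div_iff hpi]
    constructor
    · rintro ⟨⟨h1, h2⟩, h3⟩
      exact ⟨h1, Nat.lt_succ_of_le (Nat.le_log_of_pow_le hp.one_lt h3)⟩
    · rintro ⟨h1, h2⟩
      refine ⟨⟨h1, by omega⟩, ?_⟩
      refine Nat.pow_le_of_le_log ?_ (by omega)
      rintro rfl
      simp at h2
      omega
  rw [this]
  simp

theorem hanson_dvd (n : ℕ) :
    Nat.lcmUpto n * ((n / 2).factorial * (n / 3).factorial * (n / 7).factorial *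
      (n / 43).factorial * (n / 1806).factorial) ∣ Nat.lcmUpto (n / 1806) * n.factorial := by
  have hL := Nat.lcmUpto_ne_zero
  have hF := Nat.factorial_ne_zero
  rw [← Nat.factorization_prime_le_iff_dvd (by simp [hL, hF]) (by simp [hL, hF])]
  intro p hp
  rw [Nat.factorization_mul (hL _) (by simp [hF]), Nat.factorization_mul (by simp [hF]) (hF _),
    Nat.factorization_mul (by simp [hF]) (hF _), Nat.factorization_mul (by simp [hF]) (hF _),
    Nat.factorization_mul (hF _) (hF _), Nat.factorization_mul (hL _) (hF _)]
  simp only [Finsupp.add_apply]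
  rw [Nat.factorization_lcmUpto _ hp, Nat.factorization_lcmUpto _ hp]
  have hb : ∀ a, Nat.log p (n / a) < Nat.log p n + 1 := fun a =>
    Nat.lt_succ_of_le (Nat.log_mono_right (Nat.div_le_self _ _))
  have hb1 : Nat.log p n < Nat.log p n + 1 := Nat.lt_succ_self _
  rw [Nat.factorization_factorial hp (hb 2), Nat.factorization_factorial hp (hb 3),
    Nat.factorization_factorial hp (hb 7), Nat.factorization_factorial hp (hb 43),
    Nat.factorization_factorial hp (hb 1806), Nat.factorization_factorial hp hb1,
    log_eq_sum_ite hp (hb 1806)]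
  nth_rewrite 1 [log_eq_sum_ite hp hb1]
  simp only [← Finset.sum_add_distrib]
  apply Finset.sum_le_sum
  intro i _
  have key := hanson_floor (n / p ^ i)
  have hc : ∀ a, n / a / p ^ i = n / p ^ i / a := fun a => by
    rw [Nat.div_div_eq_div_mul, Nat.div_div_eq_div_mul, mul_comm]
  simp only [hc]
  exact key

theorem factorial_div_pow_le (m k : ℕ) {x y : ℝ} (hx : 0 < x) (hy : 0 < y) :
    ((m + k).factorial : ℝ) * x ^ m * y ^ k ≤ (x + y) ^ (m + k) * (m.factorial * k.factorial) := by
  have h1 : x ^ m * y ^ k * ((m + k).choose m : ℝ) ≤ (x + y) ^ (m + k) := by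
    rw [add_pow]
    have := Finset.single_le_sum
      (f := fun j => x ^ j * y ^ (m + k - j) * ((m + k).choose j : ℝ)) (s := Finset.range (m + k + 1))
      (fun j _ => by positivity) (Finset.mem_range.2 (by omega : m < m + k + 1))
    simpa using this
  have h2 : ((m + k).factorial : ℝ) = (m + k).choose m * m.factorial * k.factorial := by
    have := Nat.choose_mul_factorial_mul_factorial (Nat.le_add_right m k)
    rw [Nat.add_sub_cancel_left] at this
    exact_mod_cast this.symm
  rw [h2]
  calc _ = (x ^ m * y ^ k * ((m + k).choose m : ℝ)) * (m.factorial * k.factorial) := by ring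
    _ ≤ _ := by gcongr

/-- `m! / x^m`. -/
noncomputable def hansonG (m : ℕ) (x : ℝ) : ℝ := m.factorial / x ^ m

theorem hansonG_pos (m : ℕ) {x : ℝ} (hx : 0 < x) : 0 < hansonG m x := by
  unfold hansonG; positivity

theorem hansonG_le (m k : ℕ) {x y : ℝ} (hx : 0 < x) (hy : 0 < y) :
    hansonG (m + k) (x + y) ≤ hansonG m x * hansonG k y := by
  unfold hansonG
  rw [div_mul_div_comm, div_le_div_iff₀ (by positivity) (by positivity)]
  have := factorial_div_pow_le m k hx hy
  linarith

theorem hanson_multinomial (a b c d e : ℕ) :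
    ((a + b + c + d + e).factorial : ℝ) ≤
      (a.factorial * b.factorial * c.factorial * d.factorial * e.factorial : ℝ) *
      (2 ^ a * 3 ^ b * 7 ^ c * 43 ^ d * 1806 ^ e) := by
  have h1 := hansonG_le (a + b + c + d) e (x := 1/2 + 1/3 + 1/7 + 1/43) (y := 1/1806)
    (by norm_num) (by norm_num)
  have h2 := hansonG_le (a + b + c) d (x := 1/2 + 1/3 + 1/7) (y := 1/43)
    (by norm_num) (by norm_num)
  have h3 := hansonG_le (a + b) c (x := 1/2 + 1/3) (y := 1/7) (by norm_num) (by norm_num)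
  have h4 := hansonG_le a b (x := 1/2) (y := 1/3) (by norm_num) (by norm_num)
  have e1 : hansonG (a + b + c + d + e) (1/2 + 1/3 + 1/7 + 1/43 + 1/1806)
      = ((a + b + c + d + e).factorial : ℝ) := by
    unfold hansonG; norm_num
  rw [e1] at h1
  have p1 := (hansonG_pos e (x := 1/1806) (by norm_num)).le
  have p2 := (hansonG_pos d (x := 1/43) (by norm_num)).le
  have p3 := (hansonG_pos c (x := 1/7) (by norm_num)).le
  calc _ ≤ _ := h1
    _ ≤ (((hansonG a (1/2) * hansonG b (1/3)) * hansonG c (1/7)) * hansonG d (1/43))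
        * hansonG e (1/1806) := by
      refine mul_le_mul_of_nonneg_right (h2.trans ?_) p1
      refine mul_le_mul_of_nonneg_right (h3.trans ?_) p2
      exact mul_le_mul_of_nonneg_right h4 p3
    _ = _ := by
      unfold hansonG
      simp only [one_div, inv_pow, div_inv_eq_mul]
      ring

theorem hanson_sum_le (n : ℕ) : n / 2 + n / 3 + n / 7 + n / 43 + n / 1806 ≤ n := by
  have := hanson_floor n
  split_ifs at this <;> omega

theorem hanson_le_sum (n : ℕ) : n ≤ n / 2 + n / 3 + n / 7 + n / 43 + n / 1806 + 4 := by
  have h2 := Nat.div_add_mod n 2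
  have h3 := Nat.div_add_mod n 3
  have h7 := Nat.div_add_mod n 7
  have h43 := Nat.div_add_mod n 43
  have h1806 := Nat.div_add_mod n 1806
  have g2 := Nat.mod_lt n (by norm_num : 0 < 2)
  have g3 := Nat.mod_lt n (by norm_num : 0 < 3)
  have g7 := Nat.mod_lt n (by norm_num : 0 < 7)
  have g43 := Nat.mod_lt n (by norm_num : 0 < 43)
  have g1806 := Nat.mod_lt n (by norm_num : 0 < 1806)
  generalize n / 2 = a at *
  generalize n / 3 = b at *
  generalize n / 7 = c at *
  generalize n / 43 = d at *
  generalize n / 1806 = e at *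
  generalize n % 2 = a' at *
  generalize n % 3 = b' at *
  generalize n % 7 = c' at *
  generalize n % 43 = d' at *
  generalize n % 1806 = e' at *
  have : 1806 * n < 1806 * (a + b + c + d + e + 5) := by linarith
  omega

theorem hanson_fact (n M : ℕ) (hn : 1 ≤ n) (hM : M = n / 2 + n / 3 + n / 7 + n / 43 + n / 1806) :
    n.factorial ≤ M.factorial * n ^ 4 := by
  have hMn : M ≤ n := hM ▸ hanson_sum_le n
  have hMn4 : n ≤ M + 4 := hM ▸ hanson_le_sum n
  clear hM
  obtain ⟨k, rfl⟩ := Nat.exists_eq_add_of_le hMn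
  rw [← Nat.factorial_mul_ascFactorial]
  refine Nat.mul_le_mul_left _ ((Nat.ascFactorial_le_pow_add _ _).trans ?_)
  exact Nat.pow_le_pow_right hn (by omega)

theorem hanson_rec (n : ℕ) (hn : 1 ≤ n) :
    (Nat.lcmUpto n : ℝ) ≤ Nat.lcmUpto (n / 1806) * (n : ℝ) ^ 4 *
      (2 ^ (n / 2) * 3 ^ (n / 3) * 7 ^ (n / 7) * 43 ^ (n / 43) * 1806 ^ (n / 1806)) := by
  have h1 := Nat.le_of_dvd (Nat.mul_pos (Nat.lcmUpto_pos _) (Nat.factorial_pos _)) (hanson_dvd n)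
  obtain ⟨M, hM⟩ : ∃ M, M = n / 2 + n / 3 + n / 7 + n / 43 + n / 1806 := ⟨_, rfl⟩
  have h2 := hanson_fact n M hn hM
  have h3 := hanson_multinomial (n / 2) (n / 3) (n / 7) (n / 43) (n / 1806)
  rw [← hM] at h3
  have h1' : (Nat.lcmUpto n : ℝ) * (((n / 2).factorial : ℝ) * (n / 3).factorial * (n / 7).factorial *
      (n / 43).factorial * (n / 1806).factorial) ≤ Nat.lcmUpto (n / 1806) * n.factorial := by
    exact_mod_cast h1
  have h2' : (n.factorial : ℝ) ≤ M.factorial * (n : ℝ) ^ 4 := by exact_mod_cast h2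
  set P : ℝ := (((n / 2).factorial : ℝ) * (n / 3).factorial * (n / 7).factorial *
      (n / 43).factorial * (n / 1806).factorial) with hP
  have hPpos : 0 < P := by positivity
  refine le_of_mul_le_mul_right ?_ hPpos
  calc _ ≤ _ := h1'
    _ ≤ Nat.lcmUpto (n / 1806) * (M.factorial * (n : ℝ) ^ 4) := by gcongr
    _ ≤ Nat.lcmUpto (n / 1806) * ((P * (2 ^ (n / 2) * 3 ^ (n / 3) * 7 ^ (n / 7) * 43 ^ (n / 43) * 1806 ^ (n / 1806))) * (n : ℝ) ^ 4) := by gcongr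
    _ = _ := by ring

set_option exponentiation.threshold 3000 in
theorem hanson_const : 903 * Real.log 2 + 602 * Real.log 3 + 258 * Real.log 7 + 42 * Real.log 43
    + Real.log 1806 + Real.log 3 + 28 ≤ 1806 * Real.log 3 := by
  have he : (28 : ℝ) ≤ 28 * Real.log 2.72 := by
    have : (1 : ℝ) ≤ Real.log 2.72 := by
      rw [Real.le_log_iff_exp_le (by norm_num)]
      have := Real.exp_one_lt_d9
      linarith
    linarith
  have h : Real.log ((2:ℝ) ^ 903 * 3 ^ 602 * 7 ^ 258 * 43 ^ 42 * 1806 * 3 * 2.72 ^ 28)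
      ≤ Real.log (3 ^ 1806) := by
    apply Real.log_le_log (by positivity)
    norm_num
  rw [Real.log_mul (by positivity) (by positivity), Real.log_mul (by positivity) (by positivity),
    Real.log_mul (by positivity) (by positivity), Real.log_mul (by positivity) (by positivity),
    Real.log_mul (by positivity) (by positivity), Real.log_mul (by positivity) (by positivity)] at h
  simp only [Real.log_pow] at h
  push_cast at h
  linarith

theorem hanson_large (n : ℕ) (hn : 2048 ≤ n) (ih : Nat.lcmUpto (n / 1806) ≤ 3 ^ (n / 1806)) :
    Nat.lcmUpto n ≤ 3 ^ n := by
  have h := hanson_rec n (by omega)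
  have hn0 : (0 : ℝ) < n := by exact_mod_cast (by omega : 0 < n)
  have hnR : (2048 : ℝ) ≤ n := by exact_mod_cast hn
  have ih' : (Nat.lcmUpto (n / 1806) : ℝ) ≤ 3 ^ (n / 1806) := by exact_mod_cast ih
  have h' : (Nat.lcmUpto n : ℝ) ≤ 3 ^ (n / 1806) * (n : ℝ) ^ 4 *
      (2 ^ (n / 2) * 3 ^ (n / 3) * 7 ^ (n / 7) * 43 ^ (n / 43) * 1806 ^ (n / 1806)) :=
    h.trans (by gcongr)
  have hlog := Real.log_le_log (by exact_mod_cast Nat.lcmUpto_pos n) h'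
  rw [Real.log_mul (by positivity) (by positivity), Real.log_mul (by positivity) (by positivity),
    Real.log_mul (by positivity) (by positivity), Real.log_mul (by positivity) (by positivity),
    Real.log_mul (by positivity) (by positivity), Real.log_mul (by positivity) (by positivity)] at hlog
  simp only [Real.log_pow] at hlog
  have hfl : ∀ a : ℕ, ((n / a : ℕ) : ℝ) ≤ (n : ℝ) / a := fun a => Nat.cast_div_le
  have l2 := mul_le_mul_of_nonneg_right (hfl 2) (Real.log_nonneg (by norm_num : (1:ℝ) ≤ 2))
  have l3 := mul_le_mul_of_nonneg_right (hfl 3) (Real.log_nonneg (by norm_num : (1:ℝ) ≤ 3))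
  have l7 := mul_le_mul_of_nonneg_right (hfl 7) (Real.log_nonneg (by norm_num : (1:ℝ) ≤ 7))
  have l43 := mul_le_mul_of_nonneg_right (hfl 43) (Real.log_nonneg (by norm_num : (1:ℝ) ≤ 43))
  have l1806 := mul_le_mul_of_nonneg_right (hfl 1806) (Real.log_nonneg (by norm_num : (1:ℝ) ≤ 1806))
  have l1806' := mul_le_mul_of_nonneg_right (hfl 1806) (Real.log_nonneg (by norm_num : (1:ℝ) ≤ 3))
  have hln : Real.log n ≤ n / 2048 - 1 + 11 * Real.log 2 := by
    have h1 := Real.log_le_sub_one_of_pos (x := (n : ℝ) / 2048) (by positivity)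
    rw [Real.log_div (by positivity) (by norm_num)] at h1
    have h2 : Real.log 2048 = 11 * Real.log 2 := by
      rw [show (2048 : ℝ) = 2 ^ 11 by norm_num, Real.log_pow]; norm_num
    linarith
  have hl2 := Real.log_two_lt_d9
  have hc := mul_le_mul_of_nonneg_left hanson_const (by positivity : 0 ≤ (n : ℝ) / 1806)
  have hfin : Real.log (Nat.lcmUpto n) ≤ Real.log (3 ^ n) := by
    rw [Real.log_pow]
    push_cast at *
    have hc' : (n : ℝ) / 2 * Real.log 2 + n / 3 * Real.log 3 + n / 7 * Real.log 7 + n / 43 * Real.log 43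
      + n / 1806 * Real.log 1806 + n / 1806 * Real.log 3 + n / 1806 * 28 ≤ n * Real.log 3 := by
      have e1 : (n : ℝ) / 1806 * (1806 * Real.log 3) = n * Real.log 3 := by ring
      rw [e1] at hc
      refine le_trans (le_of_eq ?_) hc
      ring
    linarith
  have := (Real.log_le_log_iff (by exact_mod_cast Nat.lcmUpto_pos n) (by positivity)).1 hfin
  exact_mod_cast this

theorem hanson (n : ℕ) : Nat.lcmUpto n ≤ 3 ^ n := by
  induction n using Nat.strong_induction_on with
  | _ n ih =>
    rcases Nat.lt_or_ge n 2048 with h | h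
    · exact hanson_small n h.le
    · exact hanson_large n h (ih _ (Nat.div_lt_self (by omega) (by norm_num)))

theorem IW_split (P : ℕ → Prop) (n : ℕ) (hn : n ≠ 0) : ∃ a b, n = a * b ∧
    (∀ p : ℕ, p.Prime → p ∣ a → ¬ P p) ∧ (∀ p : ℕ, p.Prime → p ∣ b → P p) := by
  induction n using induction_on_primes with
  | zero => exact absurd rfl hn
  | one =>
    refine ⟨1, 1, rfl, ?_, ?_⟩ <;>
    · intro p hp h
      exact absurd (Nat.dvd_one.1 h) hp.ne_one
  | prime_mul q n hq ih =>
    obtain ⟨a, b, rfl, ha, hb⟩ := ih (right_ne_zero_of_mul hn)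
    by_cases h : P q
    · refine ⟨a, q * b, by ring, ha, ?_⟩
      intro p hp hpd
      rcases (Nat.Prime.dvd_mul hp).1 hpd with h1 | h1
      · rwa [(Nat.prime_dvd_prime_iff_eq hp hq).1 h1]
      · exact hb p hp h1
    · refine ⟨q * a, b, by ring, ?_, hb⟩
      intro p hp hpd
      rcases (Nat.Prime.dvd_mul hp).1 hpd with h1 | h1
      · rwa [(Nat.prime_dvd_prime_iff_eq hp hq).1 h1]
      · exact ha p hp h1

theorem Qzero_ne_zero (ρ : ℝ) (N : ℕ) : Qzero ρ N ≠ 0 := by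
  classical
  unfold Qzero
  rw [Ne, Finset.lcm_eq_zero_iff]
  simp

theorem dvd_Qzero {ρ : ℝ} {N a : ℕ} (h1 : 1 ≤ a) (h2 : a ≤ N) (h : NoLargeFactor ρ N a) :
    a ∣ Qzero ρ N := by
  classical
  unfold Qzero
  exact Finset.dvd_lcm (f := id) (by simp [h1, h2, h])

theorem Qzero_dvd (ρ : ℝ) (N : ℕ) : Qzero ρ N ∣ (Finset.Icc 1 N).lcm id := by
  classical
  unfold Qzero
  exact Finset.lcm_dvd fun b hb => Finset.dvd_lcm (f := id) (Finset.mem_filter.1 hb).1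

theorem Qzero_noLarge (ρ : ℝ) (N : ℕ) : NoLargeFactor ρ N (Qzero ρ N) := by
  classical
  intro p hp hpd
  have h1 : p ∣ ∏ b ∈ (Finset.Icc 1 N).filter (NoLargeFactor ρ N), id b := by
    refine hpd.trans ?_
    unfold Qzero
    exact Finset.lcm_dvd fun b hb => Finset.dvd_prod_of_mem id hb
  obtain ⟨b, hb, hpb⟩ := (Nat.Prime.prime hp).exists_mem_finset_dvd h1
  exact (Finset.mem_filter.1 hb).2 p hp hpb

theorem mem_IWDenom {ρ : ℝ} {N n : ℕ} : n ∈ IWDenom ρ N ↔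
    ∃ d m, d ∣ Qzero ρ N ∧ 1 ≤ m ∧ m ≤ N ∧ AllFactorsLarge ρ N m ∧ d * m = n := by
  classical
  unfold IWDenom
  simp only [Finset.mem_image, Finset.mem_product, Nat.mem_divisors, Finset.mem_filter,
    Finset.mem_Icc, Prod.exists]
  constructor
  · rintro ⟨d, m, ⟨⟨h1, _⟩, ⟨h2, h3⟩, h4⟩, h5⟩
    exact ⟨d, m, h1, h2, h3, h4, h5⟩
  · rintro ⟨d, m, h1, h2, h3, h4, h5⟩
    exact ⟨d, m, ⟨⟨h1, Qzero_ne_zero ρ N⟩, ⟨h2, h3⟩, h4⟩, h5⟩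

theorem IW_a (ρ : ℝ) (N : ℕ) : Finset.Icc 1 N ⊆ IWDenom ρ N := by
  intro n hn
  rw [Finset.mem_Icc] at hn
  obtain ⟨a, b, rfl, ha, hb⟩ :=
    IW_split (fun p => (N : ℝ) ^ (ρ / 2) < (p : ℝ) ∧ p ≤ N) n (by omega)
  have ha0 : 0 < a := Nat.pos_of_ne_zero (by rintro rfl; simp at hn)
  have hb0 : 0 < b := Nat.pos_of_ne_zero (by rintro rfl; simp at hn)
  refine mem_IWDenom.2 ⟨a, b, dvd_Qzero ha0 ?_ ha, hb0, ?_, hb, rfl⟩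
  · exact (Nat.le_mul_of_pos_right a hb0).trans hn.2
  · exact (Nat.le_mul_of_pos_left b ha0).trans hn.2

theorem IW_b (ρ : ℝ) (N : ℕ) : (IWDenom ρ N).lcm id = (Finset.Icc 1 N).lcm id := by
  apply Nat.dvd_antisymm
  · refine Finset.lcm_dvd fun n hn => ?_
    obtain ⟨d, m, hd, hm1, hmN, hm, rfl⟩ := mem_IWDenom.1 hn
    have hcop : Nat.Coprime d m := by
      apply Nat.Coprime.coprime_dvd_left hd
      apply Nat.coprime_of_dvd
      intro p hp h1 h2
      exact Qzero_noLarge ρ N p hp h1 (hm p hp h2)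
    exact hcop.mul_dvd_of_dvd_of_dvd (hd.trans (Qzero_dvd ρ N))
      (Finset.dvd_lcm (f := id) (Finset.mem_Icc.2 ⟨hm1, hmN⟩))
  · exact Finset.lcm_dvd fun n hn => Finset.dvd_lcm (f := id) (IW_a ρ N hn)

theorem Qzero_dvd_pow (ρ : ℝ) (hρ : 0 < ρ) (N : ℕ) (hN : 1 ≤ N) :
    Qzero ρ N ∣ Nat.lcmUpto ⌊(N : ℝ) ^ (ρ / 2)⌋₊ ^ (2 * ⌈(2 : ℝ) / ρ⌉₊) := by
  set y : ℝ := (N : ℝ) ^ (ρ / 2) with hy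
  set D : ℕ := ⌈(2 : ℝ) / ρ⌉₊ with hD
  have hN1 : (1 : ℝ) ≤ N := by exact_mod_cast hN
  have hy1 : 1 ≤ y := Real.one_le_rpow hN1 (by positivity)
  have hNy : (N : ℝ) ≤ y ^ D := by
    calc (N : ℝ) = y ^ (2 / ρ) := by
          rw [hy, ← Real.rpow_mul (by positivity)]
          field_simp
          simp
      _ ≤ y ^ (D : ℝ) := Real.rpow_le_rpow_of_exponent_le hy1 (Nat.le_ceil _)
      _ = y ^ D := Real.rpow_natCast _ _
  rw [← Nat.factorization_prime_le_iff_dvd (Qzero_ne_zero ρ N) (pow_ne_zero _ (Nat.lcmUpto_ne_zero _))]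
  intro p hp
  rw [Nat.factorization_pow]
  simp only [Finsupp.smul_apply, smul_eq_mul]
  rw [Nat.factorization_lcmUpto _ hp]
  by_cases hpd : p ∣ Qzero ρ N
  swap
  · rw [Nat.factorization_eq_zero_of_not_dvd hpd]; exact Nat.zero_le _
  have h1 : (Qzero ρ N).factorization p ≤ Nat.log p N := by
    rw [← Nat.factorization_lcmUpto N hp]
    exact (Nat.factorization_le_iff_dvd (Qzero_ne_zero ρ N) (Nat.lcmUpto_ne_zero _)).2
      (Qzero_dvd ρ N) p
  have hpN : p ≤ N := by
    by_contra hlt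
    have := hp.factorization_pos_of_dvd (Qzero_ne_zero ρ N) hpd
    rw [Nat.log_of_lt (by omega)] at h1
    omega
  have hpy : (p : ℝ) ≤ y := by
    by_contra hlt
    exact Qzero_noLarge ρ N p hp hpd ⟨not_le.1 hlt, hpN⟩
  have hpM : p ≤ ⌊y⌋₊ := Nat.le_floor hpy
  set l := Nat.log p ⌊y⌋₊ with hl
  have hl1 : 1 ≤ l := Nat.le_log_of_pow_le hp.one_lt (by simpa using hpM)
  have hylt : y < (p : ℝ) ^ (l + 1) := by
    have h2 : ⌊y⌋₊ < p ^ (l + 1) := Nat.lt_pow_succ_log_self hp.one_lt _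
    have h3 : y < ⌊y⌋₊ + 1 := Nat.lt_floor_add_one y
    have h4 : ((⌊y⌋₊ + 1 : ℕ) : ℝ) ≤ ((p ^ (l + 1) : ℕ) : ℝ) := by exact_mod_cast h2
    push_cast at h4
    linarith
  have hNle : N ≤ p ^ ((l + 1) * D) := by
    have : (N : ℝ) ≤ ((p : ℝ) ^ (l + 1)) ^ D := hNy.trans (by gcongr)
    rw [← pow_mul] at this
    exact_mod_cast this
  have h5 : Nat.log p N ≤ (l + 1) * D := by
    have := Nat.log_mono_right (b := p) hNle
    rwa [Nat.log_pow hp.one_lt] at this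
  calc _ ≤ _ := h1
    _ ≤ (l + 1) * D := h5
    _ ≤ (2 * l) * D := Nat.mul_le_mul_right _ (by omega)
    _ = _ := by ring

theorem Qzero_le (ρ : ℝ) (hρ : 0 < ρ) (N : ℕ) (hN : 1 ≤ N) :
    (Qzero ρ N : ℝ) ≤ (3 : ℝ) ^ (2 * (⌈(2 : ℝ) / ρ⌉₊ : ℝ) * (N : ℝ) ^ (ρ / 2)) := by
  have h1 := Nat.le_of_dvd (pow_pos (Nat.lcmUpto_pos _) _) (Qzero_dvd_pow ρ hρ N hN)
  have h2 : Qzero ρ N ≤ (3 ^ ⌊(N : ℝ) ^ (ρ / 2)⌋₊) ^ (2 * ⌈(2 : ℝ) / ρ⌉₊) :=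
    h1.trans (Nat.pow_le_pow_left (hanson _) _)
  have h3 : (Qzero ρ N : ℝ) ≤ ((3 : ℝ) ^ ⌊(N : ℝ) ^ (ρ / 2)⌋₊) ^ (2 * ⌈(2 : ℝ) / ρ⌉₊) := by
    exact_mod_cast h2
  refine h3.trans ?_
  rw [← pow_mul, ← Real.rpow_natCast]
  apply Real.rpow_le_rpow_of_exponent_le (by norm_num)
  push_cast
  have := Nat.floor_le (by positivity : 0 ≤ (N : ℝ) ^ (ρ / 2))
  rw [mul_comm]
  gcongr

theorem IW_asymp (ρ : ℝ) (hρ : 0 < ρ) (C : ℝ) :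
    ∀ᶠ N : ℕ in Filter.atTop, Real.log N + C * (N : ℝ) ^ (ρ / 2) ≤ (N : ℝ) ^ ρ := by
  have h1 : ∀ᶠ x : ℝ in Filter.atTop, Real.log x ≤ x ^ (ρ / 2) := by
    have := (isLittleO_log_rpow_atTop (by positivity : 0 < ρ / 2)).bound one_pos
    filter_upwards [this, Filter.eventually_ge_atTop 1] with x hx hx1
    rw [one_mul, Real.norm_of_nonneg (Real.log_nonneg hx1),
      Real.norm_of_nonneg (by positivity)] at hx
    exact hx
  have h2 : ∀ᶠ x : ℝ in Filter.atTop, 1 + C ≤ x ^ (ρ / 2) :=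
    (tendsto_rpow_atTop (by positivity : 0 < ρ / 2)).eventually_ge_atTop _
  have h3 : ∀ᶠ x : ℝ in Filter.atTop, Real.log x + C * x ^ (ρ / 2) ≤ x ^ ρ := by
    filter_upwards [h1, h2, Filter.eventually_ge_atTop 1] with x a b c
    have hx : (0 : ℝ) < x := by linarith
    have e : x ^ ρ = x ^ (ρ / 2) * x ^ (ρ / 2) := by
      rw [← Real.rpow_add hx]; congr 1; ring
    have hp : 0 < x ^ (ρ / 2) := by positivity
    rw [e]
    nlinarith
  exact tendsto_natCast_atTop_atTop.eventually h3

theorem IW_d (ρ : ℝ) (hρ : 0 < ρ) : ∃ N₀ : ℕ, ∀ N : ℕ, N₀ ≤ N → ∀ n ∈ IWDenom ρ N,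
      (n : ℝ) ≤ max (N : ℝ) (Real.exp ((N : ℝ) ^ ρ)) := by
  obtain ⟨N₀, h⟩ := Filter.eventually_atTop.1
    (IW_asymp ρ hρ (2 * (⌈(2 : ℝ) / ρ⌉₊ : ℝ) * Real.log 3))
  refine ⟨N₀ + 1, fun N hN n hn => le_max_of_le_right ?_⟩
  have hN1 : 1 ≤ N := by omega
  have hNpos : (0 : ℝ) < N := by exact_mod_cast hN1
  obtain ⟨d, m, hd, hm1, hmN, hm, rfl⟩ := mem_IWDenom.1 hn
  have h1 : (d : ℝ) ≤ Qzero ρ N := by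
    exact_mod_cast Nat.le_of_dvd (Nat.pos_of_ne_zero (Qzero_ne_zero ρ N)) hd
  have h2 := h1.trans (Qzero_le ρ hρ N hN1)
  have h3 : (m : ℝ) ≤ N := by exact_mod_cast hmN
  push_cast
  calc (d : ℝ) * m ≤ (3 : ℝ) ^ (2 * (⌈(2 : ℝ) / ρ⌉₊ : ℝ) * (N : ℝ) ^ (ρ / 2)) * N := by gcongr
    _ = Real.exp (Real.log N + (2 * (⌈(2 : ℝ) / ρ⌉₊ : ℝ) * Real.log 3) * (N : ℝ) ^ (ρ / 2)) := by
      rw [Real.exp_add, Real.exp_log hNpos, Real.rpow_def_of_pos (by norm_num), mul_comm]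
      congr 2
      ring
    _ ≤ _ := Real.exp_le_exp.2 (h N (by omega))

/-- Properties of the Ionescu–Wainger denominator sets: for `ρ ∈ (0,2)` and
`D = ⌈2/ρ⌉`, (a) `{1,…,N} ⊆ P_N`; (b) `lcm P_N = lcm(1,…,N) ≤ 3^N`;
(c) `Q₀ ≤ 3^{2D·N^{ρ/2}}`, and every element of `P_N` is at most
`max(N, e^{N^ρ})` for `N` sufficiently large depending on `ρ`. -/
theorem IWDenom_properties (ρ : ℝ) (hρ : 0 < ρ ∧ ρ < 2) :
    (∀ N : ℕ, 1 ≤ N → Finset.Icc 1 N ⊆ IWDenom ρ N) ∧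
    (∀ N : ℕ, 1 ≤ N →
      (IWDenom ρ N).lcm id = (Finset.Icc 1 N).lcm id ∧
      (IWDenom ρ N).lcm id ≤ 3 ^ N) ∧
    (∀ N : ℕ, 1 ≤ N →
      (Qzero ρ N : ℝ) ≤ (3 : ℝ) ^ (2 * (⌈(2 : ℝ) / ρ⌉₊ : ℝ) * (N : ℝ) ^ (ρ / 2))) ∧
    (∃ N₀ : ℕ, ∀ N : ℕ, N₀ ≤ N → ∀ n ∈ IWDenom ρ N,
      (n : ℝ) ≤ max (N : ℝ) (Real.exp ((N : ℝ) ^ ρ))) := by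
  refine ⟨fun N _ => IW_a ρ N, fun N _ => ⟨IW_b ρ N, ?_⟩, fun N hN => Qzero_le ρ hρ.1 N hN,
    IW_d ρ hρ.1⟩
  rw [IW_b ρ N]
  exact hanson N
end
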